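/- Fix an integer n ≥ 2 and a real t > 0, and let B ∈ B_n(t). Then: (a) every compact representative of B has strictly more than n points; and (b) d_n(B) = diam B, i.e., every partition of a representative of B into n nonempty parts has some part of diameter arbitrarily close to diam B from below, and the infimum over such partitions of the maximal part diameter equals diam B. -/

import Mathlib

/-- The metric on `Fin n` in which every nonzero distance equals `t`. -/
noncomputable def simplexMetric (n : ℕ) (t : ℝ) (ht : 0 < t) : MetricSpace (Fin n) where
  dist i j := if i = j then 0 else t
  dist_self i := by simp
  dist_comm i j := by by_cases h : i = j <;> simp [h, Ne.symm, eq_comm]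
  dist_triangle i j k := by
    by_cases h1 : i = k <;> by_cases h2 : i = j <;> by_cases h3 : j = k <;>
      simp_all <;> linarith
  eq_of_dist_eq_zero := by
    intro i j h
    by_cases hij : i = j
    · exact hij
    · simp [hij] at h; exact absurd h (ne_of_gt ht)

/-- The point of the Gromov–Hausdorff space corresponding to the simplex `tΔ_n`,
the `n`-point metric space all of whose nonzero distances equal `t`. -/
noncomputable def simplexGH (n : ℕ) (hn : 0 < n) (t : ℝ) (ht : 0 < t) :
    GromovHausdorff.GHSpace :=
  letI := simplexMetric n t ht
  haveI : Nonempty (Fin n) := ⟨⟨0, hn⟩⟩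
  GromovHausdorff.toGHSpace (Fin n)

/-- The class `Δ₁` of the one-point metric space. -/
noncomputable def onePointGH : GromovHausdorff.GHSpace := simplexGH 1 one_pos 1 one_pos

/-- The diameter of (a representative of) a point of the Gromov–Hausdorff space. -/
noncomputable def ghDiam (X : GromovHausdorff.GHSpace) : ℝ :=
  Metric.diam (Set.univ : Set X.Rep)

/-- A partition of a type `Z` into `n` nonempty parts. -/
def IsPartitionInto {Z : Type*} (n : ℕ) (P : Fin n → Set Z) : Prop :=
  (∀ i, (P i).Nonempty) ∧ Pairwise (Function.onFun Disjoint P) ∧ (⋃ i, P i) = Set.univ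

open GromovHausdorff

/-- A surjection which distorts distances by at most `ε` bounds the Gromov–Hausdorff distance
by `ε / 2`. -/
theorem ghDist_le_of_surjective {X : Type*} {Y : Type*} [MetricSpace X] [CompactSpace X]
    [Nonempty X] [MetricSpace Y] [CompactSpace Y] [Nonempty Y] (Φ : X → Y)
    (hΦ : Function.Surjective Φ) {ε : ℝ}
    (h : ∀ x y, |dist x y - dist (Φ x) (Φ y)| ≤ ε) : ghDist X Y ≤ ε / 2 := by
  have key := ghDist_le_of_approx_subsets (s := (Set.univ : Set X)) (fun x => Φ x)
    (ε₁ := 0) (ε₂ := ε) (ε₃ := 0) (fun x => ⟨x, Set.mem_univ x, (dist_self x).le⟩)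
    (fun y => by
      obtain ⟨x, rfl⟩ := hΦ y
      exact ⟨⟨x, Set.mem_univ x⟩, (dist_self _).le⟩)
    (fun x y => h x y)
  linarith

/-- The diameter is at most twice the Gromov–Hausdorff distance to a one-point space. -/
theorem diam_le_two_mul_ghDist_of_subsingleton (X : Type*) (Y : Type*) [MetricSpace X]
    [CompactSpace X] [Nonempty X] [MetricSpace Y] [CompactSpace Y] [Nonempty Y] [Subsingleton Y] :
    Metric.diam (Set.univ : Set X) ≤ 2 * ghDist X Y := by
  have hfin : Metric.hausdorffEDist (Set.range (optimalGHInjl X Y))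
      (Set.range (optimalGHInjr X Y)) ≠ ⊤ :=
    Metric.hausdorffEDist_ne_top_of_nonempty_of_bounded (Set.range_nonempty _)
      (Set.range_nonempty _)
      (isCompact_range (isometry_optimalGHInjl X Y).continuous).isBounded
      (isCompact_range (isometry_optimalGHInjr X Y).continuous).isBounded
  have hnear : ∀ δ > 0, ∀ x : X, ∃ y : Y,
      dist (optimalGHInjl X Y x) (optimalGHInjr X Y y) < ghDist X Y + δ := by
    intro δ hδ x
    obtain ⟨_, ⟨y, rfl⟩, hy⟩ := Metric.exists_dist_lt_of_hausdorffDist_lt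
      (Set.mem_range_self x) (r := ghDist X Y + δ)
      (by rw [hausdorffDist_optimal]; linarith) hfin
    exact ⟨y, hy⟩
  have h0 : 0 ≤ ghDist X Y := by
    rw [← hausdorffDist_optimal]; exact Metric.hausdorffDist_nonneg
  refine Metric.diam_le_of_forall_dist_le (by positivity) fun x _ x' _ => ?_
  refine le_of_forall_pos_le_add fun δ hδ => ?_
  obtain ⟨y, hy⟩ := hnear (δ / 2) (by positivity) x
  obtain ⟨y', hy'⟩ := hnear (δ / 2) (by positivity) x'
  rw [Subsingleton.elim y' y] at hy'
  have htri := dist_triangle_right (optimalGHInjl X Y x) (optimalGHInjl X Y x')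
    (optimalGHInjr X Y y)
  rw [(isometry_optimalGHInjl X Y).dist_eq] at htri
  linarith

theorem dist_simplexGH_le_of_surjective_to {n : ℕ} (hn : 0 < n) {t : ℝ} (ht : 0 < t)
    (B : GHSpace) (Φ : B.Rep → Fin n) (hΦ : Function.Surjective Φ) {ε : ℝ}
    (h : ∀ x y, |dist x y - if Φ x = Φ y then 0 else t| ≤ ε) :
    dist B (simplexGH n hn t ht) ≤ ε / 2 := by
  let := simplexMetric n t ht
  have : Nonempty (Fin n) := ⟨⟨0, hn⟩⟩
  rw [← B.toGHSpace_rep]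
  exact ghDist_le_of_surjective Φ hΦ h

theorem dist_simplexGH_le_of_surjective_from {n : ℕ} (hn : 0 < n) {t : ℝ} (ht : 0 < t)
    (B : GHSpace) (Φ : Fin n → B.Rep) (hΦ : Function.Surjective Φ) {ε : ℝ}
    (h : ∀ i j, |(if i = j then 0 else t) - dist (Φ i) (Φ j)| ≤ ε) :
    dist B (simplexGH n hn t ht) ≤ ε / 2 := by
  let := simplexMetric n t ht
  have : Nonempty (Fin n) := ⟨⟨0, hn⟩⟩
  rw [dist_comm, ← B.toGHSpace_rep]
  exact ghDist_le_of_surjective Φ hΦ h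

theorem ghDiam_le_two_mul_dist_onePointGH (B : GHSpace) : ghDiam B ≤ 2 * dist B onePointGH := by
  let := simplexMetric 1 1 one_pos
  have h := diam_le_two_mul_ghDist_of_subsingleton B.Rep (Fin 1)
  unfold ghDist at h
  rwa [B.toGHSpace_rep] at h

theorem dist_le_ghDiam {B : GHSpace} (x y : B.Rep) : dist x y ≤ ghDiam B :=
  Metric.dist_le_diam_of_mem isCompact_univ.isBounded (Set.mem_univ x) (Set.mem_univ y)

/-- For `B ∈ 𝓑_n(t)` (i.e. `d_GH(B, Δ₁) = d_GH(B, tΔ_n)` and `diam B ≥ 2t`):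
(a) every compact representative of `B` has strictly more than `n` points, and
(b) `d_n(B) = diam B`, where `d_n` is the infimum over partitions into `n` nonempty parts
of the maximal diameter of a part. -/
theorem mem_Bnt_card_and_dn.{u} (n : ℕ) (hn : 2 ≤ n) (t : ℝ) (ht : 0 < t)
    (B : GromovHausdorff.GHSpace)
    (hBmid : dist B onePointGH = dist B (simplexGH n (by omega) t ht))
    (hBdiam : 2 * t ≤ ghDiam B) :
    (∀ (Z : Type u) [MetricSpace Z] [CompactSpace Z] [Nonempty Z],
      GromovHausdorff.toGHSpace Z = B → (n : ℕ∞) < ENat.card Z) ∧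
    sInf { r : ℝ | ∃ P : Fin n → Set B.Rep,
        IsPartitionInto n P ∧ r = ⨆ i, Metric.diam (P i) } = ghDiam B := by
  have hn0 : 0 < n := by omega
  have hdist : ghDiam B ≤ 2 * dist B (simplexGH n hn0 t ht) :=
    hBmid ▸ ghDiam_le_two_mul_dist_onePointGH B
  have hcard : (n : ℕ∞) < ENat.card B.Rep := by
    by_contra! hle
    have hfin : Finite B.Rep := by
      rw [← ENat.card_lt_top]
      exact hle.trans_lt (ENat.natCast_lt_top n)
    have := Fintype.ofFinite B.Rep
    rw [ENat.card_eq_coe_fintype_card, Nat.cast_le] at hle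
    obtain ⟨e⟩ : Nonempty (B.Rep ↪ Fin n) :=
      Function.Embedding.nonempty_of_card_le (by simpa using hle)
    have hs : Function.Surjective (Function.invFun e) := Function.invFun_surjective e.injective
    have := dist_simplexGH_le_of_surjective_from hn0 ht B _ hs (ε := ghDiam B - t) fun i j => by
      have h1 := dist_le_ghDiam (Function.invFun e i) (Function.invFun e j)
      have h2 := dist_nonneg (x := Function.invFun e i) (y := Function.invFun e j)
      rw [abs_le]
      split_ifs with hij
      · subst hij
        simp only [dist_self]
        constructor <;> linarith
      · constructor <;> linarith
    linarith
  refine ⟨fun Z _ _ _ hZ => ?_, ?_⟩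
  · obtain ⟨e⟩ := toGHSpace_eq_toGHSpace_iff_isometryEquiv.1 (hZ.trans B.toGHSpace_rep.symm)
    have hZcard : ENat.card Z = ENat.card B.Rep := by
      apply le_antisymm
      · exact ENat.card_le_card_of_injective e.injective
      · exact ENat.card_le_card_of_injective e.symm.injective
    rwa [hZcard]
  have hmax : ∀ P : Fin n → Set B.Rep, IsPartitionInto n P →
      (⨆ i, Metric.diam (P i)) = ghDiam B := by
    rintro P ⟨hne, hdisj, hcover⟩
    have : Nonempty (Fin n) := ⟨⟨0, hn0⟩⟩
    refine le_antisymm (ciSup_le fun i =>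
      Metric.diam_mono (Set.subset_univ _) isCompact_univ.isBounded) ?_
    by_contra! hlt
    choose Φ hΦ using Set.iUnion_eq_univ_iff.1 hcover
    have huniq : ∀ x i, x ∈ P i → Φ x = i := fun x i hx => by
      by_contra hxi
      exact Set.disjoint_left.1 (hdisj hxi) (hΦ x) hx
    have hs : Function.Surjective Φ := fun i => by
      obtain ⟨x, hx⟩ := hne i
      exact ⟨x, huniq x i hx⟩
    have hd := dist_simplexGH_le_of_surjective_to hn0 ht B Φ hs
      (ε := max (⨆ i, Metric.diam (P i)) (ghDiam B - t)) fun x y => by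
        split_ifs with hxy
        · rw [sub_zero, abs_of_nonneg dist_nonneg]
          refine le_max_of_le_left (le_trans ?_
            (le_ciSup (Set.finite_range fun i => Metric.diam (P i)).bddAbove (Φ x)))
          exact Metric.dist_le_diam_of_mem (isCompact_univ.isBounded.subset (Set.subset_univ _))
            (hΦ x) (hxy ▸ hΦ y)
        · have h1 := dist_le_ghDiam x y
          have h2 := dist_nonneg (x := x) (y := y)
          refine le_max_of_le_right (abs_le.2 ⟨?_, ?_⟩) <;> linarith
    have hε : max (⨆ i, Metric.diam (P i)) (ghDiam B - t) < ghDiam B :=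
      max_lt hlt (by linarith)
    linarith
  have hex : ∃ P : Fin n → Set B.Rep, IsPartitionInto n P := by
    have : Nonempty (Fin n) := ⟨⟨0, hn0⟩⟩
    obtain ⟨e⟩ : Nonempty (Fin n ↪ B.Rep) := by
      rcases finite_or_infinite B.Rep with hfin | hinf
      · have := Fintype.ofFinite B.Rep
        rw [ENat.card_eq_coe_fintype_card, Nat.cast_lt] at hcard
        exact Function.Embedding.nonempty_of_card_le (by simpa using hcard.le)
      · exact ⟨Fin.valEmbedding.trans (Infinite.natEmbedding B.Rep)⟩
    have hs : Function.Surjective (Function.invFun e) := Function.invFun_surjective e.injective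
    refine ⟨fun i => Function.invFun e ⁻¹' {i}, fun i => hs i, fun i j hij => ?_, ?_⟩
    · exact Disjoint.preimage _ (Set.disjoint_singleton.2 hij)
    · ext x
      simp
  have hset : { r : ℝ | ∃ P : Fin n → Set B.Rep,
      IsPartitionInto n P ∧ r = ⨆ i, Metric.diam (P i) } = {ghDiam B} := by
    obtain ⟨P, hP⟩ := hex
    refine Set.eq_singleton_iff_unique_mem.2 ⟨⟨P, hP, (hmax P hP).symm⟩, ?_⟩
    rintro _ ⟨Q, hQ, rfl⟩
    exact hmax Q hQ
  rw [hset, csInf_singleton]
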